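/- arXiv:1310.0960 — 6 statements merged into one kernel-verified Lean document; each statement's English description precedes it below -/
import Mathlib

section
/- Let L ≥ 1 be a natural number and let C ≥ 0, ε₀ ≥ 0 and γ > 0 be real numbers. Then C^L · ∑_{n=1}^{L} (L! · binom(L−1, n−1) / n!) · ε₀^n · γ^{−(L−n)} ≤ (C·ε₀ + L·C/γ)^L. -/
theorem factorial_div_factorial_le_pow {n m : ℕ} (h : n ≤ m) :
    (m.factorial : ℝ) / n.factorial ≤ (m : ℝ) ^ (m - n) := by
  rw [div_le_iff₀' (by positivity)]
  have h₁ := Nat.factorial_mul_descFactorial (Nat.sub_le m n)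
  rw [Nat.sub_sub_self h] at h₁
  rw [← h₁]
  push_cast
  gcongr
  exact_mod_cast Nat.descFactorial_le_pow m (m - n)

theorem sum_factorial_mul_choose_le (m : ℕ) {x γ : ℝ} (hx : 0 ≤ x) (hγ : 0 < γ) :
    ∑ n ∈ Finset.Icc 1 (m + 1),
        (((m + 1).factorial : ℝ) * (m.choose (n - 1) : ℝ) / (n.factorial : ℝ)) *
          x ^ n * (γ ^ (m + 1 - n))⁻¹
      ≤ x * (x + (m + 1 : ℕ) / γ) ^ m := by
  rw [← Finset.Ico_add_one_right_eq_Icc, Finset.sum_Ico_eq_sum_range, add_pow, Finset.mul_sum]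
  refine Finset.sum_le_sum fun k hk => ?_
  have hkm : k + 1 ≤ m + 1 := Finset.mem_range.mp hk
  have h := factorial_div_factorial_le_pow hkm
  rw [Nat.add_sub_add_right] at h
  rw [add_comm 1 k, Nat.add_sub_cancel, Nat.add_sub_add_right]
  calc _ = ((m + 1).factorial / (k + 1).factorial : ℝ) *
        (m.choose k * x ^ (k + 1) * (γ ^ (m - k))⁻¹) := by ring
    _ ≤ ((m + 1 : ℕ) : ℝ) ^ (m - k) * (m.choose k * x ^ (k + 1) * (γ ^ (m - k))⁻¹) := by
        gcongr
    _ = _ := by rw [div_pow]; ring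


/-- Equation (5) of the paper: for `L ≥ 1`, `C ≥ 0`, `ε₀ ≥ 0`, `γ > 0`,
`C^L · ∑_{n=1}^{L} (L!·binom(L−1,n−1)/n!) · ε₀^n · γ^{−(L−n)} ≤ (C·ε₀ + L·C/γ)^L`. -/
theorem sum_kappa_bound (L : ℕ) (hL : 1 ≤ L) (C ε₀ γ : ℝ)
    (hC : 0 ≤ C) (hε₀ : 0 ≤ ε₀) (hγ : 0 < γ) :
    C ^ L * ∑ n ∈ Finset.Icc 1 L,
        ((L.factorial : ℝ) * ((L - 1).choose (n - 1) : ℝ) / (n.factorial : ℝ)) *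
          ε₀ ^ n * (γ ^ (L - n))⁻¹
      ≤ (C * ε₀ + L * C / γ) ^ L := by
  obtain ⟨m, rfl⟩ := Nat.exists_eq_add_of_le' hL
  rw [Nat.add_sub_cancel]
  set y : ℝ := (m + 1 : ℕ) / γ
  have hy : 0 ≤ y := by positivity
  calc _ ≤ C ^ (m + 1) * (ε₀ * (ε₀ + y) ^ m) := by
        gcongr
        exact sum_factorial_mul_choose_le m hε₀ hγ
    _ ≤ C ^ (m + 1) * ((ε₀ + y) * (ε₀ + y) ^ m) := by
        gcongr
        exact le_add_of_nonneg_right hy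
    _ = (C * (ε₀ + y)) ^ (m + 1) := by rw [mul_pow, pow_succ' (ε₀ + y)]
    _ = _ := by
        congr 1
        simp only [y]
        ring
end

section
/- Let k ≥ 2 be an integer and let C ≥ 1, a ≥ 0 and ε ≥ 0 be real numbers satisfying ε ≤ (1/C)·(1/(C·k))^{1/(k−1)} − (1/(C·k))^{k/(k−1)} − a. Define h(x) := (C·x + a)^k + ε and x̃ := (1/C)·(1/(C·k))^{1/(k−1)} − a. Then x̃ ≥ 0 and for every real x with 0 ≤ x ≤ x̃ one has 0 ≤ h(x) ≤ x̃; in particular h(x̃) ≤ x̃, so h maps the interval [0, x̃] into itself. -/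
/-- The renormalization map `h(x) = (C·x + a)^k + ε` maps `[0, x̃]` into itself, where
`x̃ = (1/C)·(1/(C·k))^{1/(k−1)} − a`, provided
`ε ≤ (1/C)·(1/(C·k))^{1/(k−1)} − (1/(C·k))^{k/(k−1)} − a`. -/
theorem renormalization_map_invariant (k : ℕ) (hk : 2 ≤ k) (C a ε : ℝ)
    (hC : 1 ≤ C) (ha : 0 ≤ a) (hε : 0 ≤ ε)
    (hcond : ε ≤ (1 / C) * (1 / (C * k)) ^ ((1 : ℝ) / (k - 1)) -
        (1 / (C * k)) ^ ((k : ℝ) / (k - 1)) - a) :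
    0 ≤ (1 / C) * (1 / (C * k)) ^ ((1 : ℝ) / (k - 1)) - a ∧
      ∀ x : ℝ, 0 ≤ x → x ≤ (1 / C) * (1 / (C * k)) ^ ((1 : ℝ) / (k - 1)) - a →
        0 ≤ (C * x + a) ^ k + ε ∧
          (C * x + a) ^ k + ε ≤ (1 / C) * (1 / (C * k)) ^ ((1 : ℝ) / (k - 1)) - a := by
  have hk0 : (0 : ℝ) ≤ k := Nat.cast_nonneg k
  have hC0 : 0 < C := by linarith
  have hbase : (0 : ℝ) ≤ 1 / (C * k) := by positivity
  have hpow : (1 / (C * k)) ^ ((k : ℝ) / (k - 1)) =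
      ((1 / (C * k)) ^ ((1 : ℝ) / (k - 1))) ^ k := by
    rw [← Real.rpow_mul_natCast hbase, one_div_mul_eq_div]
  rw [hpow] at hcond
  have hq : 0 ≤ (1 / (C * k)) ^ ((1 : ℝ) / (k - 1)) := Real.rpow_nonneg hbase _
  generalize (1 / (C * k)) ^ ((1 : ℝ) / (k - 1)) = q at hcond hq ⊢
  have hqk : 0 ≤ q ^ k := pow_nonneg hq k
  refine ⟨by linarith, fun x hx hxle => ?_⟩
  have hnonneg : 0 ≤ C * x + a := by positivity
  have hle : C * x + a ≤ q := by
    have hmul : C * x ≤ C * (1 / C * q - a) := mul_le_mul_of_nonneg_left hxle hC0.le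
    have hsimp : C * (1 / C * q - a) = q - C * a := by field_simp
    nlinarith
  have hpowle : (C * x + a) ^ k ≤ q ^ k := pow_le_pow_left₀ hnonneg hle k
  exact ⟨by positivity, by linarith⟩
end

section
/- Let k ≥ 2 be an integer and let C ≥ 1, a ≥ 0 and ε ≥ 0 be real numbers satisfying ε ≤ (1/C)·(1/(C·k))^{1/(k−1)} − (1/(C·k))^{k/(k−1)} − a. Define h(x) := (C·x + a)^k + ε and x̃ := (1/C)·(1/(C·k))^{1/(k−1)} − a, and define the iterates ε_0 := ε and ε_{n+1} := h(ε_n). Then for every natural number n one has 0 ≤ ε_n ≤ x̃. -/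
/-- All iterates of `ε` under the renormalization map `h(x) = (C·x + a)^k + ε` stay in
`[0, x̃]`, where `x̃ = (1/C)·(1/(C·k))^{1/(k−1)} − a`, provided
`ε ≤ (1/C)·(1/(C·k))^{1/(k−1)} − (1/(C·k))^{k/(k−1)} − a`. -/
theorem renormalization_iterates_bounded (k : ℕ) (hk : 2 ≤ k) (C a ε : ℝ)
    (hC : 1 ≤ C) (ha : 0 ≤ a) (hε : 0 ≤ ε)
    (hcond : ε ≤ (1 / C) * (1 / (C * k)) ^ ((1 : ℝ) / (k - 1)) -
        (1 / (C * k)) ^ ((k : ℝ) / (k - 1)) - a)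
    (E : ℕ → ℝ) (hE0 : E 0 = ε) (hEs : ∀ n, E (n + 1) = (C * E n + a) ^ k + ε) :
    ∀ n, 0 ≤ E n ∧ E n ≤ (1 / C) * (1 / (C * k)) ^ ((1 : ℝ) / (k - 1)) - a := by
  have hr : (0 : ℝ) ≤ 1 / (C * k) := by positivity
  have hpow : (1 / (C * k)) ^ ((k : ℝ) / (k - 1)) =
      ((1 / (C * k)) ^ ((1 : ℝ) / (k - 1))) ^ k := by
    rw [← Real.rpow_mul_natCast hr, div_mul_eq_mul_div, one_mul]
  rw [hpow] at hcond
  have hs : 0 ≤ (1 / (C * k)) ^ ((1 : ℝ) / (k - 1)) := Real.rpow_nonneg hr _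
  generalize (1 / (C * k)) ^ ((1 : ℝ) / (k - 1)) = s at hcond hs ⊢
  intro n
  induction n with
  | zero =>
    rw [hE0]
    exact ⟨hε, by linarith [pow_nonneg hs k]⟩
  | succ n ih =>
    obtain ⟨h0, h1⟩ := ih
    have hb : 0 ≤ C * E n + a := by positivity
    have hle : C * E n + a ≤ s := by
      have h2 : C * E n ≤ C * (1 / C * s - a) := by gcongr
      have h3 : C * (1 / C * s - a) = s - C * a := by field_simp
      linarith [le_mul_of_one_le_left ha hC]
    have hk' : (C * E n + a) ^ k ≤ s ^ k := by gcongr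
    rw [hEs]
    exact ⟨by positivity, by linarith⟩
end

section
/- Let k ≥ 2 and h ≥ 0 be natural numbers and let n, e : ℕ → ℕ be sequences satisfying: n 0 = 1; for every t < h, e t ≤ n t and n (t+1) = k·(n t − e t); and n h = e h with n h ≥ 1. Then ∑_{t=0}^{h} e t ≥ h·(k−1) + 1. -/
/-- Truncating the tree at depth `m` (where it still has a vertex) leaves at least
`m * (k - 1) + 1` leaves: the error sites above depth `m` and all vertices at depth `m`. -/
theorem truncated_tree_leaf_count {k m : ℕ} {n e : ℕ → ℕ} (hn0 : n 0 = 1)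
    (hstep : ∀ t < m, e t ≤ n t ∧ n (t + 1) = k * (n t - e t)) (hpos : 1 ≤ n m) :
    m * (k - 1) + 1 ≤ ∑ t ∈ Finset.range m, e t + n m := by
  induction m with
  | zero => simp [hn0]
  | succ m ih =>
    obtain ⟨hle, hnext⟩ := hstep m m.lt_succ_self
    obtain ⟨i, hi⟩ := Nat.exists_eq_add_of_le hle
    rw [hi, Nat.add_sub_cancel_left] at hnext
    rw [hnext] at hpos
    have hipos : 1 ≤ i := Nat.pos_of_mul_pos_left hpos
    have hkpos : 1 ≤ k := Nat.pos_of_mul_pos_right hpos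
    have hm := ih (fun t ht => hstep t (ht.trans m.lt_succ_self)) (by omega)
    obtain ⟨c, rfl⟩ := Nat.exists_eq_add_of_le' hkpos
    rw [Finset.sum_range_succ, hnext]
    simp only [Nat.add_sub_cancel] at hm ⊢
    nlinarith [Nat.mul_le_mul_left c hipos]

/-- A tree of height `h` with full `k`-fold branching at internal vertices and leaves
exactly at the error sites has at least `h·(k−1)+1` error sites (leaves). Here `n t`
counts vertices at depth `t` and `e t` counts leaves at depth `t`. -/
theorem tree_error_count (k h : ℕ) (hk : 2 ≤ k) (n e : ℕ → ℕ) (hn0 : n 0 = 1)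
    (hstep : ∀ t < h, e t ≤ n t ∧ n (t + 1) = k * (n t - e t))
    (hleaf : n h = e h) (hpos : 1 ≤ n h) :
    h * (k - 1) + 1 ≤ ∑ t ∈ Finset.range (h + 1), e t := by
  rw [Finset.sum_range_succ, ← hleaf]
  exact truncated_tree_leaf_count hn0 hstep hpos
end

section
/- Let k ≥ 2 and h ≥ 0 be natural numbers and let n, e : ℕ → ℕ be sequences satisfying: for every t < h, e t ≤ n t and n (t+1) = k·(n t − e t); and n h = e h with n h ≥ 1. Then ∑_{t=0}^{h} e t ≥ h·(k−1) + n 0. -/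
/-- Forest version of the tree-leaf count: a forest of `n 0` rooted trees of height at
most `h`, with full `k`-fold branching at internal vertices, leaves exactly at the error
sites, and at least one vertex at depth `h`, has at least `h·(k−1) + n 0` leaves. -/
theorem forest_error_count (k h : ℕ) (hk : 2 ≤ k) (n e : ℕ → ℕ)
    (hstep : ∀ t < h, e t ≤ n t ∧ n (t + 1) = k * (n t - e t))
    (hleaf : n h = e h) (hpos : 1 ≤ n h) :
    h * (k - 1) + n 0 ≤ ∑ t ∈ Finset.range (h + 1), e t := by
  suffices 1 ≤ n 0 ∧ h * (k - 1) + n 0 ≤ ∑ t ∈ Finset.range (h + 1), e t from this.2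
  induction h generalizing n e with
  | zero => simp [hleaf] at hpos ⊢; exact hpos
  | succ h ih =>
    obtain ⟨hroot, hbound⟩ := ih (fun t => n (t + 1)) (fun t => e (t + 1))
      (fun t ht => hstep (t + 1) (by omega)) hleaf hpos
    obtain ⟨hle, hnext⟩ := hstep 0 (by omega)
    rw [Finset.sum_range_succ']
    obtain ⟨m, hm⟩ := Nat.exists_eq_add_of_le hle
    obtain ⟨j, rfl⟩ := Nat.exists_eq_add_of_le' (show 1 ≤ k by omega)
    simp only [zero_add, hm, Nat.add_sub_cancel_left] at hnext hroot hbound ⊢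
    rw [hnext] at hroot hbound
    have hm_pos : 1 ≤ m := Nat.pos_of_mul_pos_left hroot
    refine ⟨by omega, ?_⟩
    simp only [Nat.add_sub_cancel] at hbound ⊢
    nlinarith [Nat.mul_le_mul_left j hm_pos]
end

section
/- Fix an integer k ≥ 2, a real constant C ≥ 1, reals ε ≥ 0 and ε₀ ≥ 0, and a function γ : ℕ → ℝ with γ t > 0 for all t. For natural numbers M, m define K(M, m) := (k·M)! · binom(k·M − 1, m − 1) / m! (as a real number). For a natural number t_m define S_γ(t_m, ε, ε₀) as the finite sum, over all pairs of sequences n, e : {0,…,t_m} → ℕ satisfying n 0 = 1, e t ≤ n t for all t ≤ t_m, 1 ≤ n (t+1) ≤ k·(n t − e t) for all t < t_m, and e t_m = n t_m, of the term [∏_{t=0}^{t_m−1} binom(n t, e t) · K(n t − e t, n (t+1)) · ε^{e t} · C^{k·(n t − e t)} · (γ t)^{−(k·(n t − e t) − n (t+1))}] · ε₀^{n t_m}. Then for every t_m ≥ 1: S_γ(t_m, ε, ε₀) ≤ S_γ(t_m − 1, ε, ε₁), where ε₁ := (C·ε₀ + k^{t_m}·C/(γ (t_m − 1)))^k + ε.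 -/
/-- `K(M, m) = (k·M)! · binom(k·M − 1, m − 1) / m!`, the bound on the number of ways to
arrange the `k·M` lines leaving `M` sites so that they enter exactly `m` sites. -/
noncomputable def K (k M m : ℕ) : ℝ :=
  (Nat.factorial (k * M) : ℝ) * ((k * M - 1).choose (m - 1) : ℝ) / (Nat.factorial m : ℝ)

/-- `S γ (t_m, ε, ε₀)`: the weighted sum over graphs of height `t_m`, indexed by pairs of
sequences `n, e : {0,…,t_m} → ℕ` with `n 0 = 1`, `e t ≤ n t`, `1 ≤ n (t+1) ≤ k·(n t − e t)`
for `t < t_m`, and `e t_m = n t_m`.  (Since these constraints force `n t ≤ k^t ≤ k^{t_m}`,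
taking values in `Fin (k^{t_m} + 1)` captures every admissible pair of sequences.) -/
noncomputable def S (k : ℕ) (C : ℝ) (γ : ℕ → ℝ) (tm : ℕ) (ε ε₀ : ℝ) : ℝ :=
  ∑ ne ∈ Finset.univ.filter
      (fun ne : (Fin (tm + 1) → Fin (k ^ tm + 1)) × (Fin (tm + 1) → Fin (k ^ tm + 1)) =>
        (ne.1 0 : ℕ) = 1 ∧
        (∀ t : Fin (tm + 1), (ne.2 t : ℕ) ≤ (ne.1 t : ℕ)) ∧
        (∀ t : Fin tm, 1 ≤ (ne.1 t.succ : ℕ) ∧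
          (ne.1 t.succ : ℕ) ≤ k * ((ne.1 t.castSucc : ℕ) - (ne.2 t.castSucc : ℕ))) ∧
        (ne.2 (Fin.last tm) : ℕ) = (ne.1 (Fin.last tm) : ℕ)),
    (∏ t : Fin tm,
        ((ne.1 t.castSucc : ℕ).choose (ne.2 t.castSucc : ℕ) : ℝ) *
          K k ((ne.1 t.castSucc : ℕ) - (ne.2 t.castSucc : ℕ)) (ne.1 t.succ : ℕ) *
          ε ^ (ne.2 t.castSucc : ℕ) *
          C ^ (k * ((ne.1 t.castSucc : ℕ) - (ne.2 t.castSucc : ℕ))) *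
          (γ (t : ℕ) ^ (k * ((ne.1 t.castSucc : ℕ) - (ne.2 t.castSucc : ℕ)) -
              (ne.1 t.succ : ℕ)))⁻¹) *
      ε₀ ^ (ne.1 (Fin.last tm) : ℕ)

open Finset

lemma K_nonneg (k M m : ℕ) : 0 ≤ K k M m := by
  unfold K; positivity

lemma K_le (k M m : ℕ) (hm : 1 ≤ m) (hmM : m ≤ k * M) :
    K k M m ≤ ((k * M : ℕ) : ℝ) ^ (k * M - m) * ((k * M).choose m : ℝ) := by
  unfold K
  rw [div_le_iff₀ (by positivity)]
  have h₁ : (k * M).factorial ≤ (k * M) ^ (k * M - m) * m.factorial := by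
    have h' := Nat.factorial_mul_descFactorial (Nat.sub_le (k * M) m)
    rw [Nat.sub_sub_self hmM] at h'
    rw [← h', mul_comm]
    exact Nat.mul_le_mul_right _ (Nat.descFactorial_le_pow _ _)
  have h₂ : (k * M - 1).choose (m - 1) ≤ (k * M).choose m := by
    obtain ⟨m, rfl⟩ := Nat.exists_eq_add_of_le' hm
    obtain ⟨N, hN⟩ := Nat.exists_eq_add_of_le' (hm.trans hmM)
    rw [hN, Nat.choose_succ_succ]
    simp
  calc _ ≤ (((k * M) ^ (k * M - m) * m.factorial : ℕ) : ℝ) * ((k * M).choose m : ℝ) := by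
        gcongr
    _ = _ := by push_cast; ring

/-- The weight of one level of a graph, with `n` sites, `e` of them errors, and `m` sites on the
next level. -/
noncomputable def levelWeight (k : ℕ) (C ε g : ℝ) (n e m : ℕ) : ℝ :=
  (n.choose e : ℝ) * K k (n - e) m * ε ^ e * C ^ (k * (n - e)) * (g ^ (k * (n - e) - m))⁻¹

lemma levelWeight_nonneg {k : ℕ} {C ε g : ℝ} (hC : 0 ≤ C) (hε : 0 ≤ ε) (hg : 0 ≤ g)
    (n e m : ℕ) : 0 ≤ levelWeight k C ε g n e m := by
  have := K_nonneg k (n - e) m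
  unfold levelWeight; positivity

lemma sum_K_mul_le (k M : ℕ) {C g x L : ℝ} (hC : 0 ≤ C) (hg : 0 < g) (hx : 0 ≤ x)
    (hL : ((k * M : ℕ) : ℝ) ≤ L) :
    ∑ m ∈ Icc 1 (k * M), K k M m * C ^ (k * M) * (g ^ (k * M - m))⁻¹ * x ^ m ≤
      ((C * x + L * C / g) ^ k) ^ M := by
  have hL0 : 0 ≤ L := (Nat.cast_nonneg _).trans hL
  rw [← pow_mul]
  calc _ ≤ ∑ m ∈ Icc 1 (k * M),
        (C * x) ^ m * (L * C / g) ^ (k * M - m) * ((k * M).choose m : ℝ) := by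
        refine sum_le_sum fun m hm => ?_
        obtain ⟨h1, h2⟩ := mem_Icc.1 hm
        have hK : K k M m ≤ L ^ (k * M - m) * ((k * M).choose m : ℝ) :=
          (K_le k M m h1 h2).trans (by gcongr)
        calc _ ≤ L ^ (k * M - m) * ((k * M).choose m : ℝ) * C ^ (k * M) *
              (g ^ (k * M - m))⁻¹ * x ^ m := by gcongr
          _ = _ := by
              have hCp : C ^ (k * M) = C ^ m * C ^ (k * M - m) := by
                rw [← pow_add, Nat.add_sub_cancel' h2]
              rw [hCp, mul_pow, div_pow, mul_pow, div_eq_mul_inv]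
              ring
    _ ≤ ∑ m ∈ range (k * M + 1),
        (C * x) ^ m * (L * C / g) ^ (k * M - m) * ((k * M).choose m : ℝ) := by
        refine sum_le_sum_of_subset_of_nonneg (fun m hm => ?_) fun m _ _ => by positivity
        have := mem_Icc.1 hm
        exact mem_range.2 (by omega)
    _ = _ := (add_pow _ _ _).symm

lemma sum_levelWeight_mul_le (k n : ℕ) {C ε g x L : ℝ} (hC : 0 ≤ C) (hε : 0 ≤ ε) (hg : 0 < g)
    (hx : 0 ≤ x) (hL : ((k * n : ℕ) : ℝ) ≤ L) :
    ∑ e ∈ range (n + 1), ∑ m ∈ Icc 1 (k * (n - e)), levelWeight k C ε g n e m * x ^ m ≤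
      ((C * x + L * C / g) ^ k + ε) ^ n := by
  rw [add_comm _ ε, add_pow]
  refine sum_le_sum fun e _ => ?_
  have hLe : ((k * (n - e) : ℕ) : ℝ) ≤ L :=
    le_trans (by exact_mod_cast Nat.mul_le_mul_left k (Nat.sub_le n e)) hL
  calc _ = (ε ^ e * (n.choose e : ℝ)) * ∑ m ∈ Icc 1 (k * (n - e)),
        K k (n - e) m * C ^ (k * (n - e)) * (g ^ (k * (n - e) - m))⁻¹ * x ^ m := by
        rw [mul_sum]
        refine sum_congr rfl fun m _ => ?_
        unfold levelWeight; ring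
    _ ≤ (ε ^ e * (n.choose e : ℝ)) * ((C * x + L * C / g) ^ k) ^ (n - e) := by
        gcongr
        exact sum_K_mul_le k (n - e) hC hg hx hLe
    _ = _ := by ring

/-- The admissible pairs of sequences of height `tm`. -/
def graphIndex (k tm : ℕ) :
    Finset ((Fin (tm + 1) → Fin (k ^ tm + 1)) × (Fin (tm + 1) → Fin (k ^ tm + 1))) :=
  univ.filter fun ne =>
    (ne.1 0 : ℕ) = 1 ∧
    (∀ t : Fin (tm + 1), (ne.2 t : ℕ) ≤ (ne.1 t : ℕ)) ∧
    (∀ t : Fin tm, 1 ≤ (ne.1 t.succ : ℕ) ∧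
      (ne.1 t.succ : ℕ) ≤ k * ((ne.1 t.castSucc : ℕ) - (ne.2 t.castSucc : ℕ))) ∧
    (ne.2 (Fin.last tm) : ℕ) = (ne.1 (Fin.last tm) : ℕ)

lemma S_eq_sum_graphIndex (k : ℕ) (C : ℝ) (γ : ℕ → ℝ) (tm : ℕ) (ε x : ℝ) :
    S k C γ tm ε x = ∑ ne ∈ graphIndex k tm,
      (∏ t : Fin tm, levelWeight k C ε (γ t) (ne.1 t.castSucc) (ne.2 t.castSucc) (ne.1 t.succ)) *
        x ^ (ne.1 (Fin.last tm) : ℕ) := rfl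

lemma le_pow_of_mem_graphIndex {k tm : ℕ}
    {ne : (Fin (tm + 1) → Fin (k ^ tm + 1)) × (Fin (tm + 1) → Fin (k ^ tm + 1))}
    (h : ne ∈ graphIndex k tm) (t : Fin (tm + 1)) : (ne.1 t : ℕ) ≤ k ^ (t : ℕ) := by
  obtain ⟨h0, -, hs, -⟩ := (mem_filter.1 h).2
  induction t using Fin.induction with
  | zero => simp [h0]
  | succ t ih =>
    calc (ne.1 t.succ : ℕ) ≤ k * ((ne.1 t.castSucc : ℕ) - (ne.2 t.castSucc : ℕ)) := (hs t).2
      _ ≤ k * k ^ (t : ℕ) := Nat.mul_le_mul_left k ((Nat.sub_le _ _).trans ih)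
      _ = k ^ (t.succ : ℕ) := by rw [Fin.val_succ, pow_succ']

/-- Remove the last level of a pair of sequences, turning all sites of the level above it into
errors. -/
def truncate (k T : ℕ)
    (ne : (Fin (T + 1 + 1) → Fin (k ^ (T + 1) + 1)) × (Fin (T + 1 + 1) → Fin (k ^ (T + 1) + 1))) :
    (Fin (T + 1) → Fin (k ^ T + 1)) × (Fin (T + 1) → Fin (k ^ T + 1)) :=
  (fun t => ⟨min (ne.1 t.castSucc) (k ^ T), by omega⟩,
   fun t => ⟨min (if t = Fin.last T then ne.1 t.castSucc else ne.2 t.castSucc) (k ^ T), by omega⟩)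

section truncate

variable {k T : ℕ}
  {ne : (Fin (T + 1 + 1) → Fin (k ^ (T + 1) + 1)) × (Fin (T + 1 + 1) → Fin (k ^ (T + 1) + 1))}

lemma truncate_fst (hk : 1 ≤ k) (h : ne ∈ graphIndex k (T + 1)) (t : Fin (T + 1)) :
    ((truncate k T ne).1 t : ℕ) = ne.1 t.castSucc :=
  min_eq_left ((le_pow_of_mem_graphIndex h t.castSucc).trans
    (Nat.pow_le_pow_right hk (Nat.lt_succ_iff.1 t.2)))

lemma truncate_snd (hk : 1 ≤ k) (h : ne ∈ graphIndex k (T + 1)) (t : Fin (T + 1)) :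
    ((truncate k T ne).2 t : ℕ) =
      if t = Fin.last T then (ne.1 t.castSucc : ℕ) else ne.2 t.castSucc := by
  have hle : (ne.1 t.castSucc : ℕ) ≤ k ^ T := (le_pow_of_mem_graphIndex h t.castSucc).trans
    (Nat.pow_le_pow_right hk (Nat.lt_succ_iff.1 t.2))
  have he := (mem_filter.1 h).2.2.1 t.castSucc
  unfold truncate
  dsimp only
  split_ifs <;> simp <;> omega

lemma truncate_snd_castSucc (hk : 1 ≤ k) (h : ne ∈ graphIndex k (T + 1)) (t : Fin T) :
    ((truncate k T ne).2 t.castSucc : ℕ) = ne.2 t.castSucc.castSucc := by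
  rw [truncate_snd hk h, if_neg (Fin.castSucc_lt_last t).ne]

lemma truncate_mem (hk : 1 ≤ k) (h : ne ∈ graphIndex k (T + 1)) :
    truncate k T ne ∈ graphIndex k T := by
  obtain ⟨h0, he, hs, -⟩ := (mem_filter.1 h).2
  refine mem_filter.2 ⟨mem_univ _, ?_, fun t => ?_, fun t => ?_, ?_⟩
  · rw [truncate_fst hk h]; exact h0
  · rw [truncate_fst hk h, truncate_snd hk h]
    split_ifs
    · exact le_rfl
    · exact he _
  · rw [truncate_fst hk h, truncate_fst hk h, truncate_snd_castSucc hk h]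
    exact hs t.castSucc
  · rw [truncate_fst hk h, truncate_snd hk h, if_pos rfl]

end truncate

/-- The number of errors on the next to last level and the number of sites on the last one. -/
def lastLevels (k T : ℕ)
    (ne : (Fin (T + 1 + 1) → Fin (k ^ (T + 1) + 1)) × (Fin (T + 1 + 1) → Fin (k ^ (T + 1) + 1))) :
    Σ _ : ℕ, ℕ :=
  ⟨ne.2 (Fin.last T).castSucc, ne.1 (Fin.last (T + 1))⟩

lemma eq_of_truncate_eq_of_lastLevels_eq {k T : ℕ} (hk : 1 ≤ k)
    {p q : (Fin (T + 1 + 1) → Fin (k ^ (T + 1) + 1)) × (Fin (T + 1 + 1) → Fin (k ^ (T + 1) + 1))}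
    (hp : p ∈ graphIndex k (T + 1)) (hq : q ∈ graphIndex k (T + 1))
    (ht : truncate k T p = truncate k T q) (hl : lastLevels k T p = lastLevels k T q) :
    p = q := by
  obtain ⟨hle, hlm⟩ : (p.2 (Fin.last T).castSucc : ℕ) = q.2 (Fin.last T).castSucc ∧
      (p.1 (Fin.last (T + 1)) : ℕ) = q.1 (Fin.last (T + 1)) := by
    simpa only [lastLevels, Sigma.mk.injEq, heq_eq_eq] using hl
  have hp' := (mem_filter.1 hp).2.2.2.2
  have hq' := (mem_filter.1 hq).2.2.2.2
  refine Prod.ext (funext fun t => Fin.ext ?_) (funext fun t => Fin.ext ?_)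
  · induction t using Fin.lastCases with
    | last => exact hlm
    | cast t => rw [← truncate_fst hk hp, ← truncate_fst hk hq, ht]
  · induction t using Fin.lastCases with
    | last => rw [hp', hq', hlm]
    | cast t =>
      induction t using Fin.lastCases with
      | last => exact hle
      | cast t => rw [← truncate_snd_castSucc hk hp, ← truncate_snd_castSucc hk hq, ht]

/-- The renormalization recursion: summing over the lowest level of the graph,
`S_γ(t_m, ε, ε₀) ≤ S_γ(t_m − 1, ε, ε₁)` with
`ε₁ = (C·ε₀ + k^{t_m}·C/γ(t_m − 1))^k + ε`. -/
theorem S_recursion (k : ℕ) (hk : 2 ≤ k) (C : ℝ) (hC : 1 ≤ C) (ε ε₀ : ℝ)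
    (hε : 0 ≤ ε) (hε₀ : 0 ≤ ε₀) (γ : ℕ → ℝ) (hγ : ∀ t, 0 < γ t)
    (tm : ℕ) (htm : 1 ≤ tm) :
    S k C γ tm ε ε₀ ≤
      S k C γ (tm - 1) ε ((C * ε₀ + (k : ℝ) ^ tm * C / γ (tm - 1)) ^ k + ε) := by
  obtain ⟨T, rfl⟩ := Nat.exists_eq_add_of_le' htm
  have hk1 : 1 ≤ k := by omega
  have hC0 : 0 ≤ C := by linarith
  rw [Nat.add_sub_cancel, S_eq_sum_graphIndex, S_eq_sum_graphIndex,
    ← sum_fiberwise_of_maps_to (fun ne hne => truncate_mem hk1 hne)]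
  refine sum_le_sum fun q hq => ?_
  set P : ℝ :=
    ∏ t : Fin T, levelWeight k C ε (γ t) (q.1 t.castSucc) (q.2 t.castSucc) (q.1 t.succ)
  have hP : 0 ≤ P := prod_nonneg fun t _ => levelWeight_nonneg hC0 hε (hγ t).le _ _ _
  set n : ℕ := (q.1 (Fin.last T) : ℕ)
  have hn : n ≤ k ^ T := le_pow_of_mem_graphIndex hq (Fin.last T)
  set F : (Σ _ : ℕ, ℕ) → ℝ := fun s => levelWeight k C ε (γ T) n s.1 s.2 * ε₀ ^ s.2
  calc _ = ∑ p ∈ graphIndex k (T + 1) with truncate k T p = q, P * F (lastLevels k T p) := by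
        refine sum_congr rfl fun p hp => ?_
        obtain ⟨hpG, rfl⟩ := mem_filter.1 hp
        simp only [P, F, n, Fin.prod_univ_castSucc, lastLevels, truncate_fst hk1 hpG,
          truncate_snd_castSucc hk1 hpG, Fin.succ_castSucc, Fin.succ_last, Nat.succ_eq_add_one, Fin.val_castSucc,
          Fin.val_last, mul_assoc]
    _ = P * ∑ s ∈ ((graphIndex k (T + 1)).filter fun p => truncate k T p = q).image
          (lastLevels k T), F s := by
        rw [← mul_sum, sum_image]
        intro p hp p' hp' h
        obtain ⟨hpG, rfl⟩ := mem_filter.1 hp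
        obtain ⟨hpG', h'⟩ := mem_filter.1 hp'
        exact eq_of_truncate_eq_of_lastLevels_eq hk1 hpG hpG' h'.symm h
    _ ≤ P * ∑ s ∈ (range (n + 1)).sigma fun e => Icc 1 (k * (n - e)), F s := by
        refine mul_le_mul_of_nonneg_left (sum_le_sum_of_subset_of_nonneg ?_ fun s _ _ =>
          mul_nonneg (levelWeight_nonneg hC0 hε (hγ T).le _ _ _) (pow_nonneg hε₀ _)) hP
        intro s hs
        obtain ⟨p, hp, rfl⟩ := mem_image.1 hs
        obtain ⟨hpG, rfl⟩ := mem_filter.1 hp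
        obtain ⟨-, he, hs, -⟩ := (mem_filter.1 hpG).2
        have hn' : n = p.1 (Fin.last T).castSucc := truncate_fst hk1 hpG _
        rw [mem_sigma, mem_range, mem_Icc, hn']
        exact ⟨Nat.lt_succ_iff.2 (he _), hs (Fin.last T)⟩
    _ ≤ _ := by
        rw [sum_sigma]
        refine mul_le_mul_of_nonneg_left
          (sum_levelWeight_mul_le k n hC0 hε (hγ T) hε₀ ?_) hP
        rw [pow_succ']
        exact_mod_cast Nat.mul_le_mul_left k hn
end
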